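/- Let A = A^3_{r,s}(p1,p2) with unit e = e_r + e_s, let F be A-algebrizable on an open set Omega in R^3, let N be an open subset of Omega(F,A*) = {w in Omega : F(w) is invertible in A}, and let H = (h_1, h_2, h_3) : N -> R^3 be an A-antiderivative of e/F on N, i.e., at every w in N, H is Fréchet differentiable with differential xi |-> (F(w))^{-1}·xi (product in A). Then the functions h_r - h_s and h_r - h_s + h_t are first integrals of F on N: for every w in N, <∇(h_r - h_s)(w), F(w)> = 0 and <∇(h_r - h_s + h_t)(w), F(w)> = 0. -/

import Mathlib

noncomputable section

/-- The `i`-th standard basis vector of `ℝ³`. -/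
def e3 (i : Fin 3) : Fin 3 → ℝ := Pi.single i 1

/-- `A`-algebrizability (Lorch differentiability) of a vector field on an open set. -/
def IsAlgebrizable (mul : (Fin 3 → ℝ) → (Fin 3 → ℝ) → (Fin 3 → ℝ))
    (Ω : Set (Fin 3 → ℝ)) (F : (Fin 3 → ℝ) → (Fin 3 → ℝ)) : Prop :=
  ∃ F' : (Fin 3 → ℝ) → (Fin 3 → ℝ), ∀ w ∈ Ω,
    DifferentiableAt ℝ F w ∧ ∀ ξ, fderiv ℝ F w ξ = mul (F' w) ξ

/-- A vector of `ℝ³` is the combination of the standard basis with its coordinates. -/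
theorem sum_smul_e3 (x : Fin 3 → ℝ) : ∑ j, x j • e3 j = x := by
  simpa [e3] using (pi_eq_sum_univ' x).symm

/-- A bilinear product on `ℝ³` is commutative as soon as it is so on the standard basis. -/
theorem mul_comm_of_e3 {mul : (Fin 3 → ℝ) → (Fin 3 → ℝ) → (Fin 3 → ℝ)}
    (hleft : ∀ y, IsLinearMap ℝ (fun x => mul x y)) (hright : ∀ x, IsLinearMap ℝ (mul x))
    (hcomm : ∀ i j, mul (e3 i) (e3 j) = mul (e3 j) (e3 i)) (x y : Fin 3 → ℝ) :
    mul x y = mul y x := by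
  let B : (Fin 3 → ℝ) →ₗ[ℝ] (Fin 3 → ℝ) →ₗ[ℝ] (Fin 3 → ℝ) :=
    LinearMap.mk₂ ℝ mul (fun _ _ y => (hleft y).map_add _ _) (fun _ _ y => (hleft y).map_smul _ _)
      (fun x => (hright x).map_add) (fun _ x => (hright x).map_smul _)
  have hB : B = B.flip := LinearMap.ext_basis (Pi.basisFun ℝ (Fin 3)) (Pi.basisFun ℝ (Fin 3))
    fun i j => by simpa [B, e3] using hcomm i j
  exact LinearMap.congr_fun₂ hB x y

/-- Summing the values of a linear map on the standard basis against coordinates. -/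
theorem sum_apply_e3_mul (L : (Fin 3 → ℝ) →L[ℝ] (Fin 3 → ℝ)) (x : Fin 3 → ℝ) (i : Fin 3) :
    ∑ j, L (e3 j) i * x j = L x i := by
  conv_rhs => rw [← sum_smul_e3 x]
  simp [mul_comm]

/-- Let `A = A³_{r,s}(p1,p2)` with unit `e_r + e_s`, `F` `A`-algebrizable on the open set
`Ω ⊆ ℝ³`, `N` an open subset of `Ω(F,A*)`, and `H = (h₁,h₂,h₃)` an `A`-antiderivative
of `e/F` on `N` (at each `w ∈ N`, `H` is Fréchet differentiable with differential
`ξ ↦ (F(w))⁻¹·ξ`).  Then `h_r - h_s` and `h_r - h_s + h_t` are first integrals of `F`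
on `N`: `⟨∇(h_r - h_s)(w), F(w)⟩ = 0` and `⟨∇(h_r - h_s + h_t)(w), F(w)⟩ = 0` for all
`w ∈ N`. -/
theorem stmt16 (p1 p2 : ℝ)
    (r s t : Fin 3) (hrs : r ≠ s) (hrt : r ≠ t) (hst : s ≠ t)
    (mul : (Fin 3 → ℝ) → (Fin 3 → ℝ) → (Fin 3 → ℝ))
    (hlin_left : ∀ y, IsLinearMap ℝ (fun x => mul x y))
    (hlin_right : ∀ x, IsLinearMap ℝ (mul x))
    (hrr : mul (e3 r) (e3 r) = e3 r)
    (hrs' : mul (e3 r) (e3 s) = 0) (hsr : mul (e3 s) (e3 r) = 0)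
    (hrt' : mul (e3 r) (e3 t) = 0) (htr : mul (e3 t) (e3 r) = 0)
    (hss : mul (e3 s) (e3 s) = e3 s)
    (hst' : mul (e3 s) (e3 t) = e3 t) (hts : mul (e3 t) (e3 s) = e3 t)
    (htt : mul (e3 t) (e3 t) = p1 • e3 s + p2 • e3 t)
    (Ω : Set (Fin 3 → ℝ)) (hΩ : IsOpen Ω)
    (F : (Fin 3 → ℝ) → (Fin 3 → ℝ)) (halg : IsAlgebrizable mul Ω F)
    (N : Set (Fin 3 → ℝ)) (hN : IsOpen N)
    (hNsub : N ⊆ {w ∈ Ω | ∃ v, mul (F w) v = e3 r + e3 s})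
    (Finv : (Fin 3 → ℝ) → (Fin 3 → ℝ))
    (hFinv : ∀ w ∈ N, mul (F w) (Finv w) = e3 r + e3 s)
    (H : (Fin 3 → ℝ) → (Fin 3 → ℝ))
    (hH : ∀ w ∈ N, DifferentiableAt ℝ H w ∧ ∀ ξ, fderiv ℝ H w ξ = mul (Finv w) ξ) :
    ∀ w ∈ N,
      (∑ j : Fin 3,
        (fderiv ℝ H w (e3 j) r - fderiv ℝ H w (e3 j) s) * F w j) = 0 ∧
      (∑ j : Fin 3,
        (fderiv ℝ H w (e3 j) r - fderiv ℝ H w (e3 j) s + fderiv ℝ H w (e3 j) t)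
          * F w j) = 0 := by
  intro w hw
  have hcover : ∀ i, i = r ∨ i = s ∨ i = t := by omega
  have hcomm := mul_comm_of_e3 hlin_left hlin_right fun i j => by
    rcases hcover i with rfl | rfl | rfl <;> rcases hcover j with rfl | rfl | rfl <;> simp [*]
  have hunit : fderiv ℝ H w (F w) = e3 r + e3 s := by
    rw [(hH w hw).2, hcomm, hFinv w hw]
  simp only [add_mul, sub_mul, Finset.sum_add_distrib, Finset.sum_sub_distrib,
    sum_apply_e3_mul, hunit]
  simp [e3, hrs, hrs.symm, hrt.symm, hst.symm]
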